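/- arXiv:math/9903069 — 5 statements merged into one kernel-verified Lean document; each statement's English description precedes it below -/
import Mathlib

section
/- Let M be an n×n integer matrix such that M − ᵗM is unimodular (det(M − ᵗM) = ±1), let x be an integer and C an n×1 integer column. Then the (n+2)×(n+2) integer matrix M′ with block rows ((0,0,O),(1,x,O),(O,C,M)) also satisfies that M′ − ᵗM′ is unimodular; moreover det(M′ − ᵗM′) = det(M − ᵗM). -/
open Matrix

/-- Stabilization move of type (2): block rows ((0,0,O),(1,x,O),(O,C,M)). -/
def stabCol {n : ℕ} (M : Matrix (Fin n) (Fin n) ℤ) (x : ℤ) (C : Fin n → ℤ) :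
    Matrix (Fin (2 + n)) (Fin (2 + n)) ℤ :=
  Matrix.reindex finSumFinEquiv finSumFinEquiv
    (Matrix.fromBlocks !![0, 0; 1, x] 0
      (Matrix.of fun i j => if j = 1 then C i else 0) M)

/-- If `M - Mᵀ` is unimodular then so is `M' - M'ᵀ` for the column stabilization `M'`
of `M`; moreover the determinants agree. -/
theorem stabCol_unimodular (n : ℕ) (M : Matrix (Fin n) (Fin n) ℤ) (x : ℤ)
    (C : Fin n → ℤ) (h : (M - Mᵀ).det = 1 ∨ (M - Mᵀ).det = -1) :
    ((stabCol M x C - (stabCol M x C)ᵀ).det = 1 ∨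
      (stabCol M x C - (stabCol M x C)ᵀ).det = -1) ∧
    (stabCol M x C - (stabCol M x C)ᵀ).det = (M - Mᵀ).det := by
  have key : (stabCol M x C - (stabCol M x C)ᵀ).det = (M - Mᵀ).det := by
    let A : Matrix (Fin 2) (Fin 2) ℤ := !![0, -1; 1, 0]
    let B : Matrix (Fin 2) (Fin n) ℤ := of fun i j => if i = 1 then C j else 0
    let : Invertible A := ⟨!![0, 1; -1, 0], by simp [A, one_fin_two], by simp [A, one_fin_two]⟩
    have hA : ⅟A = !![0, 1; -1, 0] := rfl
    have hblocks : stabCol M x C - (stabCol M x C)ᵀ =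
        reindex finSumFinEquiv finSumFinEquiv (fromBlocks A (-B) Bᵀ (M - Mᵀ)) := by
      ext i j
      obtain ⟨i, rfl⟩ := finSumFinEquiv.surjective i
      obtain ⟨j, rfl⟩ := finSumFinEquiv.surjective j
      simp only [stabCol, Matrix.sub_apply, transpose_apply, reindex_apply, submatrix_apply,
        Equiv.symm_apply_apply]
      rcases i with i | i <;> rcases j with j | j
      · fin_cases i <;> fin_cases j <;> simp [A]
      all_goals simp [B]
    have hschur : Bᵀ * ⅟A * -B = 0 := by
      ext i j
      simp [hA, B, mul_apply]
    rw [hblocks, det_reindex_self, det_fromBlocks₁₁, hschur, sub_zero]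
    simp [A, det_fin_two]
  exact ⟨by rwa [key], key⟩
end

section
/- Let M be an n×n integer matrix such that M − ᵗM is unimodular (det(M − ᵗM) = ±1), let x be an integer and R a 1×n integer row. Then the (n+2)×(n+2) integer matrix M″ with block rows ((0,1,O),(0,x,R),(O,O,M)) also satisfies that M″ − ᵗM″ is unimodular; moreover det(M″ − ᵗM″) = det(M − ᵗM). -/
open Matrix

/-- Stabilization move of type (3): block rows ((0,1,O),(0,x,R),(O,O,M)). -/
def stabRow {n : ℕ} (M : Matrix (Fin n) (Fin n) ℤ) (x : ℤ) (R : Fin n → ℤ) :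
    Matrix (Fin (2 + n)) (Fin (2 + n)) ℤ :=
  Matrix.reindex finSumFinEquiv finSumFinEquiv
    (Matrix.fromBlocks !![0, 1; 0, x]
      (Matrix.of fun i j => if i = 1 then R j else 0) 0 M)

/-- The skew part of the row stabilization, in block form. -/
theorem stabRow_sub_transpose {n : ℕ} (M : Matrix (Fin n) (Fin n) ℤ) (x : ℤ) (R : Fin n → ℤ) :
    stabRow M x R - (stabRow M x R)ᵀ =
      Matrix.reindex finSumFinEquiv finSumFinEquiv
        (Matrix.fromBlocks !![0, 1; -1, 0] (Matrix.of ![0, R]) (-(Matrix.of ![0, R])ᵀ)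
          (M - Mᵀ)) := by
  ext i j
  obtain ⟨i, rfl⟩ := finSumFinEquiv.surjective i
  obtain ⟨j, rfl⟩ := finSumFinEquiv.surjective j
  simp only [stabRow, Matrix.sub_apply, transpose_apply, reindex_apply, submatrix_apply,
    Equiv.symm_apply_apply]
  rcases i with i | i <;> rcases j with j | j
  · fin_cases i <;> fin_cases j <;> simp
  · fin_cases i <;> simp
  · fin_cases j <;> simp
  · simp

/-- A symplectic block bordered by a single row and its negated transpose does not change
the determinant. -/
theorem det_fromBlocks_symplectic {S m : Type*} [CommRing S] [Fintype m] [DecidableEq m]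
    (R : m → S) (D : Matrix m m S) :
    (Matrix.fromBlocks !![0, 1; -1, 0] (Matrix.of ![0, R]) (-(Matrix.of ![0, R])ᵀ) D).det =
      D.det := by
  let _ : Invertible (!![0, 1; -1, 0] : Matrix (Fin 2) (Fin 2) S) :=
    ⟨!![0, -1; 1, 0], by simp [one_fin_two], by simp [one_fin_two]⟩
  have schur : (-(Matrix.of ![0, R])ᵀ) * (!![0, -1; 1, 0] : Matrix (Fin 2) (Fin 2) S) *
      Matrix.of ![0, R] = 0 := by
    ext i j
    simp [mul_apply, Fin.sum_univ_two]
  rw [det_fromBlocks₁₁]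
  change _ * (D - (-(Matrix.of ![0, R])ᵀ) * (!![0, -1; 1, 0] : Matrix (Fin 2) (Fin 2) S) *
    Matrix.of ![0, R]).det = _
  rw [schur]
  simp [det_fin_two]

/-- If `M - Mᵀ` is unimodular then so is `M'' - M''ᵀ` for the row stabilization `M''`
of `M`; moreover the determinants agree. -/
theorem stabRow_unimodular (n : ℕ) (M : Matrix (Fin n) (Fin n) ℤ) (x : ℤ)
    (R : Fin n → ℤ) (h : (M - Mᵀ).det = 1 ∨ (M - Mᵀ).det = -1) :
    ((stabRow M x R - (stabRow M x R)ᵀ).det = 1 ∨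
      (stabRow M x R - (stabRow M x R)ᵀ).det = -1) ∧
    (stabRow M x R - (stabRow M x R)ᵀ).det = (M - Mᵀ).det := by
  have det_eq : (stabRow M x R - (stabRow M x R)ᵀ).det = (M - Mᵀ).det := by
    rw [stabRow_sub_transpose, det_reindex_self, det_fromBlocks_symplectic]
  exact ⟨det_eq ▸ h, det_eq⟩
end

section
/- Let M be an n×n integer matrix, x an integer and C an n×1 integer column, and let M′ be the (n+2)×(n+2) integer matrix with block rows ((0,0,O),(1,x,O),(O,C,M)). Then, in the polynomial ring ℤ[t], det(M′ − t·ᵗM′) = t · det(M − t·ᵗM). -/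
open Matrix Polynomial

/-- The Alexander matrix `M - t·ᵗM` over `ℤ[t]`. -/
noncomputable def alexMat {n : ℕ} (M : Matrix (Fin n) (Fin n) ℤ) :
    Matrix (Fin n) (Fin n) (Polynomial ℤ) :=
  M.map Polynomial.C - (Polynomial.X : Polynomial ℤ) • Mᵀ.map Polynomial.C

/-- A block matrix whose first row is `(0, a, 0)` and whose first column is `(0, b, 0)` has
determinant `-(a * b)` times that of its lower right block. -/
theorem det_fromBlocks_of_sparse_row_col {m R : Type*} [Fintype m] [DecidableEq m] [CommRing R]
    (a b c : R) (u v : m → R) (D : Matrix m m R) :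
    (Matrix.fromBlocks !![0, a; b, c] (Matrix.of fun i j => if i = 1 then v j else 0)
      (Matrix.of fun i j => if j = 1 then u i else 0) D).det = -(a * b) * D.det := by
  have factor : Matrix.fromBlocks !![0, a; b, c] (Matrix.of fun i j => if i = 1 then v j else 0)
      (Matrix.of fun i j => if j = 1 then u i else 0) D =
      Matrix.fromBlocks !![a, 0; c, 1] 0 (Matrix.of fun i j => if j = 0 then u i else 0) 1 *
        Matrix.fromBlocks !![0, 1; b, 0] (Matrix.of fun i j => if i = 1 then v j else 0) 0 D := by
    rw [Matrix.fromBlocks_multiply]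
    congr 1
    · ext i j
      fin_cases i <;> fin_cases j <;> simp
    · ext i j
      fin_cases i <;> simp [Matrix.vecHead, Matrix.vecTail]
    · ext i j
      fin_cases j <;> simp [Matrix.mul_apply]
    · ext i j
      simp [Matrix.mul_apply]
  rw [factor, Matrix.det_mul, Matrix.det_fromBlocks_zero₁₂, Matrix.det_fromBlocks_zero₂₁]
  simp [Matrix.det_fin_two, mul_assoc]

/-- The Alexander matrix of a column stabilization, in block form. -/
theorem alexMat_stabCol {n : ℕ} (M : Matrix (Fin n) (Fin n) ℤ) (x : ℤ) (C : Fin n → ℤ) :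
    alexMat (stabCol M x C) = Matrix.reindex finSumFinEquiv finSumFinEquiv
      (Matrix.fromBlocks !![0, -X; 1, Polynomial.C x - X * Polynomial.C x]
        (Matrix.of fun i j => if i = 1 then -(X * Polynomial.C (C j)) else 0)
        (Matrix.of fun i j => if j = 1 then Polynomial.C (C i) else 0) (alexMat M)) := by
  ext1 i j
  obtain ⟨i, rfl⟩ := finSumFinEquiv.surjective i
  obtain ⟨j, rfl⟩ := finSumFinEquiv.surjective j
  simp only [alexMat, stabCol, Matrix.sub_apply, Matrix.smul_apply, Matrix.map_apply,
    Matrix.transpose_apply, Matrix.reindex_apply, Matrix.submatrix_apply, Equiv.symm_apply_apply]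
  rcases i with i | i <;> rcases j with j | j
  · fin_cases i <;> fin_cases j <;> simp
  · fin_cases i <;> simp
  · fin_cases j <;> simp
  · simp

/-- Column stabilization multiplies `det(M - t·ᵗM)` by `t`. -/
theorem alexMat_det_stabCol (n : ℕ) (M : Matrix (Fin n) (Fin n) ℤ) (x : ℤ)
    (C : Fin n → ℤ) :
    (alexMat (stabCol M x C)).det = Polynomial.X * (alexMat M).det := by
  rw [alexMat_stabCol, Matrix.det_reindex_self, det_fromBlocks_of_sparse_row_col]
  simp
end

section
/- Let M be an n×n integer matrix, x an integer and R a 1×n integer row, and let M″ be the (n+2)×(n+2) integer matrix with block rows ((0,1,O),(0,x,R),(O,O,M)). Then, in the polynomial ring ℤ[t], det(M″ − t·ᵗM″) = t · det(M − t·ᵗM). -/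
open Matrix Polynomial

/-- Block determinant when the lower-left block is a left multiple of the upper-left one. -/
theorem det_fromBlocks_mul_left {m n R : Type*} [Fintype m] [Fintype n] [DecidableEq m]
    [DecidableEq n] [CommRing R] (A : Matrix m m R) (B : Matrix m n R) (L : Matrix n m R)
    (D : Matrix n n R) :
    (fromBlocks A B (L * A) D).det = A.det * (D - L * B).det := by
  have h : fromBlocks A B (L * A) D = fromBlocks 1 0 L 1 * fromBlocks A B 0 (D - L * B) := by
    simp [fromBlocks_multiply]
  rw [h, det_mul, det_fromBlocks_zero₁₂, det_fromBlocks_zero₂₁]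
  simp

/-- The Alexander matrix of a row stabilization, in block form. -/
theorem alexMat_stabRow {n : ℕ} (M : Matrix (Fin n) (Fin n) ℤ) (x : ℤ) (R : Fin n → ℤ) :
    alexMat (stabRow M x R) = Matrix.reindex finSumFinEquiv finSumFinEquiv
      (fromBlocks !![0, 1; -X, C x - X * C x]
        (Matrix.of fun i j => if i = 1 then C (R j) else 0)
        (Matrix.of (fun i (j : Fin 2) => if j = 0 then -(X * C (R i)) else 0) *
          !![0, 1; -X, C x - X * C x])
        (alexMat M)) := by
  ext1 i j
  obtain ⟨i, rfl⟩ := finSumFinEquiv.surjective i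
  obtain ⟨j, rfl⟩ := finSumFinEquiv.surjective j
  rcases i with i | i <;> rcases j with j | j
  · fin_cases i <;> fin_cases j <;> simp [alexMat, stabRow]
  · fin_cases i <;> simp [alexMat, stabRow]
  · fin_cases j <;> simp [alexMat, stabRow, Matrix.mul_apply]
  · simp [alexMat, stabRow]

/-- Row stabilization multiplies `det(M - t·ᵗM)` by `t`. -/
theorem alexMat_det_stabRow (n : ℕ) (M : Matrix (Fin n) (Fin n) ℤ) (x : ℤ)
    (R : Fin n → ℤ) :
    (alexMat (stabRow M x R)).det = Polynomial.X * (alexMat M).det := by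
  have h : (Matrix.of fun i (j : Fin 2) => if j = 0 then -(X * C (R i)) else 0) *
      (Matrix.of fun (i : Fin 2) j => if i = 1 then C (R j) else 0) = 0 := by
    ext1 i j
    simp [Matrix.mul_apply]
  rw [alexMat_stabRow, det_reindex_self, det_fromBlocks_mul_left, h]
  simp [det_fin_two]
end

section
/- Let M and N be matrices in ℳ of sizes m and n respectively, and suppose M and N are S-equivalent. Then, in the Laurent polynomial ring ℤ[t, t⁻¹], t^{−m/2}·det(M − t·ᵗM) = t^{−n/2}·det(N − t·ᵗN). In other words, the normalized Alexander polynomial Δ_M(t) := t^{−size(M)/2}·det(M − t·ᵗM) is an invariant of S-equivalence classes of matrices in ℳ. -/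
open Matrix Polynomial

/-- Square integer matrices of arbitrary size. -/
def SqMat : Type := Σ n : ℕ, Matrix (Fin n) (Fin n) ℤ

/-- Membership in ℳ: even size, and `M - Mᵀ` unimodular. -/
def InM (A : SqMat) : Prop :=
  Even A.1 ∧ ((A.2 - A.2ᵀ).det = 1 ∨ (A.2 - A.2ᵀ).det = -1)

/-- Elementary S-equivalence moves. -/
inductive SMove : SqMat → SqMat → Prop
  | congr {n : ℕ} (M P : Matrix (Fin n) (Fin n) ℤ) (hP : P.det = 1 ∨ P.det = -1) :
      SMove ⟨n, M⟩ ⟨n, P * M * Pᵀ⟩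
  | col {n : ℕ} (M : Matrix (Fin n) (Fin n) ℤ) (x : ℤ) (C : Fin n → ℤ) :
      SMove ⟨n, M⟩ ⟨2 + n, stabCol M x C⟩
  | row {n : ℕ} (M : Matrix (Fin n) (Fin n) ℤ) (x : ℤ) (R : Fin n → ℤ) :
      SMove ⟨n, M⟩ ⟨2 + n, stabRow M x R⟩

/-- S-equivalence: finite sequences of moves and their inverses. -/
def SEquiv : SqMat → SqMat → Prop := Relation.EqvGen SMove


theorem Matrix.det_fromBlocks_cross {R ι : Type*} [CommRing R] [Fintype ι] [DecidableEq ι]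
    (a b c : R) (r s : ι → R) (A : Matrix ι ι R) :
    (Matrix.fromBlocks !![0, a; b, c] (Matrix.of fun i j => if i = 1 then r j else 0)
      (Matrix.of fun i j => if j = 1 then s i else 0) A).det = -(a * b) * A.det := by
  have h : Matrix.fromBlocks !![0, a; b, c] (Matrix.of fun i j => if i = 1 then r j else 0)
      (Matrix.of fun i j => if j = 1 then s i else 0) A =
      Matrix.fromBlocks !![a, 0; c, 1] 0 (Matrix.of fun i j => if j = 0 then s i else 0) 1 *
        Matrix.fromBlocks !![0, 1; b, 0]
          (Matrix.of fun i j => if i = 1 then r j else 0) 0 A := by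
    rw [Matrix.fromBlocks_multiply]
    congr 1
    · simp
    · ext i j
      fin_cases i <;> simp [Matrix.mul_apply, -Matrix.cons_mul]
    · ext i j
      fin_cases j <;> simp [Matrix.mul_apply]
    · ext i j
      simp [Matrix.mul_apply]
  rw [h, Matrix.det_mul, Matrix.det_fromBlocks_zero₁₂, Matrix.det_fromBlocks_zero₂₁]
  simp [Matrix.det_fin_two]
  ring

theorem det_alexMat_stabCol {n : ℕ} (M : Matrix (Fin n) (Fin n) ℤ) (x : ℤ) (C : Fin n → ℤ) :
    (alexMat (stabCol M x C)).det = X * (alexMat M).det := by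
  have h : alexMat (stabCol M x C) = Matrix.reindex finSumFinEquiv finSumFinEquiv
      (Matrix.fromBlocks !![0, -X; 1, Polynomial.C x - X * Polynomial.C x]
        (Matrix.of fun i j => if i = 1 then -X * Polynomial.C (C j) else 0)
        (Matrix.of fun i j => if j = 1 then Polynomial.C (C i) else 0) (alexMat M)) := by
    rw [← Equiv.symm_apply_eq]
    ext1 i j
    rcases i with i | i <;> rcases j with j | j
    · fin_cases i <;> fin_cases j <;> simp [alexMat, stabCol]
    · fin_cases i <;> simp [alexMat, stabCol]
    · fin_cases j <;> simp [alexMat, stabCol]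
    · simp [alexMat, stabCol]
  rw [h, Matrix.det_reindex_self, Matrix.det_fromBlocks_cross]
  ring

theorem det_alexMat_stabRow {n : ℕ} (M : Matrix (Fin n) (Fin n) ℤ) (x : ℤ) (R : Fin n → ℤ) :
    (alexMat (stabRow M x R)).det = X * (alexMat M).det := by
  have h : alexMat (stabRow M x R) = Matrix.reindex finSumFinEquiv finSumFinEquiv
      (Matrix.fromBlocks !![0, 1; -X, Polynomial.C x - X * Polynomial.C x]
        (Matrix.of fun i j => if i = 1 then Polynomial.C (R j) else 0)
        (Matrix.of fun i j => if j = 1 then -X * Polynomial.C (R i) else 0) (alexMat M)) := by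
    rw [← Equiv.symm_apply_eq]
    ext1 i j
    rcases i with i | i <;> rcases j with j | j
    · fin_cases i <;> fin_cases j <;> simp [alexMat, stabRow]
    · fin_cases i <;> simp [alexMat, stabRow]
    · fin_cases j <;> simp [alexMat, stabRow]
    · simp [alexMat, stabRow]
  rw [h, Matrix.det_reindex_self, Matrix.det_fromBlocks_cross]
  ring

theorem alexMat_congr {n : ℕ} (M P : Matrix (Fin n) (Fin n) ℤ) :
    alexMat (P * M * Pᵀ) =
      P.map Polynomial.C * alexMat M * (P.map Polynomial.C)ᵀ := by
  simp [alexMat, Matrix.map_mul, Matrix.transpose_mul, Matrix.transpose_map, Matrix.mul_sub,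
    Matrix.sub_mul, Matrix.mul_assoc]

theorem det_alexMat_congr {n : ℕ} (M P : Matrix (Fin n) (Fin n) ℤ)
    (hP : P.det = 1 ∨ P.det = -1) : (alexMat (P * M * Pᵀ)).det = (alexMat M).det := by
  have h : (P.map Polynomial.C).det = Polynomial.C P.det :=
    (RingHom.map_det Polynomial.C P).symm
  rw [alexMat_congr, Matrix.det_mul, Matrix.det_mul, Matrix.det_transpose, h]
  rcases hP with hP | hP <;> simp [hP]

/-- The normalized Alexander polynomial of a square integer matrix. -/
noncomputable def normalizedAlexander (A : SqMat) : LaurentPolynomial ℤ :=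
  LaurentPolynomial.T (-((A.1 / 2 : ℕ) : ℤ)) * Polynomial.toLaurent (alexMat A.2).det

theorem normalizedAlexander_stab {n : ℕ} {M : Matrix (Fin n) (Fin n) ℤ}
    {N : Matrix (Fin (2 + n)) (Fin (2 + n)) ℤ}
    (h : (alexMat N).det = X * (alexMat M).det) :
    normalizedAlexander ⟨n, M⟩ = normalizedAlexander ⟨2 + n, N⟩ := by
  have hn : ((((2 + n) / 2 : ℕ) : ℤ)) = ((n / 2 : ℕ) : ℤ) + 1 := by omega
  simp only [normalizedAlexander, h, map_mul, Polynomial.toLaurent_X]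
  rw [← mul_assoc, ← LaurentPolynomial.T_add, hn, neg_add, neg_add_cancel_right]

theorem SMove.normalizedAlexander_eq {A B : SqMat} (h : SMove A B) :
    normalizedAlexander A = normalizedAlexander B := by
  cases h with
  | congr M P hP => simp only [normalizedAlexander, det_alexMat_congr M P hP]
  | col M x C => exact normalizedAlexander_stab (det_alexMat_stabCol M x C)
  | row M x R => exact normalizedAlexander_stab (det_alexMat_stabRow M x R)

theorem SEquiv.normalizedAlexander_eq {A B : SqMat} (h : SEquiv A B) :
    normalizedAlexander A = normalizedAlexander B := by
  induction h with
  | rel _ _ h => exact h.normalizedAlexander_eq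
  | refl _ => rfl
  | symm _ _ _ ih => exact ih.symm
  | trans _ _ _ _ _ ih₁ ih₂ => exact ih₁.trans ih₂

/-- The normalized Alexander polynomial `t^{-size(M)/2}·det(M - t·ᵗM)`, an element of
the Laurent polynomial ring `ℤ[t, t⁻¹]`, is an invariant of S-equivalence classes of
matrices in ℳ. -/
theorem normalized_alexander_sEquiv_invariant (m n : ℕ)
    (M : Matrix (Fin m) (Fin m) ℤ) (N : Matrix (Fin n) (Fin n) ℤ)
    (hM : InM ⟨m, M⟩) (hN : InM ⟨n, N⟩) (h : SEquiv ⟨m, M⟩ ⟨n, N⟩) :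
    LaurentPolynomial.T (-((m / 2 : ℕ) : ℤ)) * Polynomial.toLaurent (alexMat M).det =
      LaurentPolynomial.T (-((n / 2 : ℕ) : ℤ)) * Polynomial.toLaurent (alexMat N).det :=
  h.normalizedAlexander_eq
end
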